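/- Let A be the Cartan matrix of type E₇ with rows and columns indexed by the simple roots α, β, γ, δ, ε, η, σ in that order, where α–β–γ–δ–ε–η form a chain and σ is attached to δ in the Dynkin diagram (so A_{ii} = 2, A_{ij} = −1 if i and j are adjacent, and A_{ij} = 0 otherwise). For each index j define the simple reflection s_j : ℤ⁷ → ℤ⁷ by s_j(n) = n − (Σᵢ nᵢ A_{ij})·e_j, where e_j is the j-th standard basis vector. Let w₁ = s_ε ∘ s_β ∘ s_γ ∘ s_α ∘ s_β and w₂ = s_ε ∘ s_β ∘ s_γ ∘ s_α ∘ s_β ∘ s_η ∘ s_δ ∘ s_β. Then w₁² = id, w₂⁷ = id, w₁ ∘ w₂ ∘ w₁ = w₂⁻¹, w₁ ≠ id, w₂ ≠ id, and the group generated by w₁ and w₂ (a subgroup of the group of linear automorphisms of ℤ⁷) is isomorphic to the dihedral group of order 14. -/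

import Mathlib

/-- The Cartan matrix of type E₇, rows and columns indexed by the simple roots
α, β, γ, δ, ε, η, σ in that order (indices 0,…,6), where α–β–γ–δ–ε–η form a chain and σ is
attached to δ in the Dynkin diagram. -/
def cartanE7 : Matrix (Fin 7) (Fin 7) ℤ :=
  !![2, -1, 0, 0, 0, 0, 0;
     -1, 2, -1, 0, 0, 0, 0;
     0, -1, 2, -1, 0, 0, 0;
     0, 0, -1, 2, -1, 0, -1;
     0, 0, 0, -1, 2, -1, 0;
     0, 0, 0, 0, -1, 2, 0;
     0, 0, 0, -1, 0, 0, 2]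

/-- The linear functional n ↦ Σᵢ nᵢ A_{ij} on ℤ⁷. -/
def coeff (j : Fin 7) : (Fin 7 → ℤ) →ₗ[ℤ] ℤ :=
  ∑ i : Fin 7, cartanE7 i j • LinearMap.proj i

/-- The simple reflection s_j : ℤ⁷ → ℤ⁷, s_j(n) = n − (Σᵢ nᵢ A_{ij})·e_j, as a linear map. -/
def reflMap (j : Fin 7) : (Fin 7 → ℤ) →ₗ[ℤ] (Fin 7 → ℤ) :=
  LinearMap.id - LinearMap.smulRight (coeff j) (Pi.single j 1)

theorem reflMap_apply (j : Fin 7) (m : Fin 7 → ℤ) :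
    reflMap j m = m - (∑ i : Fin 7, cartanE7 i j * m i) • Pi.single j 1 := by
  simp only [reflMap, coeff, LinearMap.sub_apply, LinearMap.id_apply,
    LinearMap.smulRight_apply, LinearMap.coe_sum, Finset.sum_apply, LinearMap.smul_apply,
    LinearMap.proj_apply, smul_eq_mul]

theorem reflMap_involutive (j : Fin 7) : Function.Involutive (reflMap j) := by
  intro n
  have hAjj : (∑ i : Fin 7, cartanE7 i j * (Pi.single j 1 : Fin 7 → ℤ) i) = 2 := by
    fin_cases j <;> simp [cartanE7, Fin.sum_univ_seven, Pi.single_apply] <;> decide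
  rw [reflMap_apply, reflMap_apply]
  set c : ℤ := ∑ i : Fin 7, cartanE7 i j * n i with hc
  have hsum : (∑ i : Fin 7, cartanE7 i j * (n - c • Pi.single j 1 : Fin 7 → ℤ) i) = -c := by
    simp only [Pi.sub_apply, Pi.smul_apply, smul_eq_mul, mul_sub, Finset.sum_sub_distrib]
    rw [show (∑ i : Fin 7, cartanE7 i j * (c * (Pi.single j 1 : Fin 7 → ℤ) i)) =
        c * ∑ i : Fin 7, cartanE7 i j * (Pi.single j 1 : Fin 7 → ℤ) i by
      rw [Finset.mul_sum]; exact Finset.sum_congr rfl fun i _ => by ring]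
    rw [hAjj, ← hc]
    ring
  rw [hsum]
  clear_value c
  module

/-- The simple reflection s_j as a linear automorphism of ℤ⁷. -/
def simpleReflection (j : Fin 7) : (Fin 7 → ℤ) ≃ₗ[ℤ] (Fin 7 → ℤ) :=
  LinearEquiv.ofInvolutive (reflMap j) (reflMap_involutive j)

/-- w₁ = s_ε ∘ s_β ∘ s_γ ∘ s_α ∘ s_β (indices α=0, β=1, γ=2, δ=3, ε=4, η=5, σ=6);
multiplication in the automorphism group is composition, so s_β is applied first. -/
def w1 : (Fin 7 → ℤ) ≃ₗ[ℤ] (Fin 7 → ℤ) :=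
  simpleReflection 4 * simpleReflection 1 * simpleReflection 2 * simpleReflection 0 *
    simpleReflection 1

/-- w₂ = s_ε ∘ s_β ∘ s_γ ∘ s_α ∘ s_β ∘ s_η ∘ s_δ ∘ s_β. -/
def w2 : (Fin 7 → ℤ) ≃ₗ[ℤ] (Fin 7 → ℤ) :=
  simpleReflection 4 * simpleReflection 1 * simpleReflection 2 * simpleReflection 0 *
    simpleReflection 1 * simpleReflection 5 * simpleReflection 3 * simpleReflection 1

theorem refl_vec0 (a b c d e f g : ℤ) :
    simpleReflection 0 ![a, b, c, d, e, f, g] = ![b - a, b, c, d, e, f, g] := by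
  change reflMap 0 _ = _
  rw [reflMap_apply]
  ext i
  fin_cases i <;> simp [cartanE7, Fin.sum_univ_seven, Pi.single_apply] <;> ring

theorem refl_vec1 (a b c d e f g : ℤ) :
    simpleReflection 1 ![a, b, c, d, e, f, g] = ![a, a + c - b, c, d, e, f, g] := by
  change reflMap 1 _ = _
  rw [reflMap_apply]
  ext i
  fin_cases i <;> simp [cartanE7, Fin.sum_univ_seven, Pi.single_apply] <;> ring

theorem refl_vec2 (a b c d e f g : ℤ) :
    simpleReflection 2 ![a, b, c, d, e, f, g] = ![a, b, b + d - c, d, e, f, g] := by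
  change reflMap 2 _ = _
  rw [reflMap_apply]
  ext i
  fin_cases i <;> simp [cartanE7, Fin.sum_univ_seven, Pi.single_apply] <;> ring

theorem refl_vec3 (a b c d e f g : ℤ) :
    simpleReflection 3 ![a, b, c, d, e, f, g] = ![a, b, c, c + e + g - d, e, f, g] := by
  change reflMap 3 _ = _
  rw [reflMap_apply]
  ext i
  fin_cases i <;> simp [cartanE7, Fin.sum_univ_seven, Pi.single_apply] <;> ring

theorem refl_vec4 (a b c d e f g : ℤ) :
    simpleReflection 4 ![a, b, c, d, e, f, g] = ![a, b, c, d, d + f - e, f, g] := by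
  change reflMap 4 _ = _
  rw [reflMap_apply]
  ext i
  fin_cases i <;> simp [cartanE7, Fin.sum_univ_seven, Pi.single_apply] <;> ring

theorem refl_vec5 (a b c d e f g : ℤ) :
    simpleReflection 5 ![a, b, c, d, e, f, g] = ![a, b, c, d, e, e - f, g] := by
  change reflMap 5 _ = _
  rw [reflMap_apply]
  ext i
  fin_cases i <;> simp [cartanE7, Fin.sum_univ_seven, Pi.single_apply] <;> ring

theorem vec7_eta (n : Fin 7 → ℤ) : n = ![n 0, n 1, n 2, n 3, n 4, n 5, n 6] := by
  ext i
  fin_cases i <;> rfl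

theorem ext_vec7 {u v : (Fin 7 → ℤ) ≃ₗ[ℤ] (Fin 7 → ℤ)}
    (h : ∀ a b c d e f g : ℤ, u ![a, b, c, d, e, f, g] = v ![a, b, c, d, e, f, g]) : u = v := by
  apply LinearEquiv.ext
  intro n
  rw [vec7_eta n]
  exact h _ _ _ _ _ _ _

theorem w1_vec (a b c d e f g : ℤ) :
    w1 ![a, b, c, d, e, f, g] = ![-b + c, -b + d, a - b + d, d, d - e + f, f, g] := by
  simp only [w1, LinearEquiv.mul_apply, refl_vec0, refl_vec1, refl_vec2, refl_vec4]
  ext i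
  fin_cases i <;> simp <;> ring

theorem w2_vec (a b c d e f g : ℤ) :
    w2 ![a, b, c, d, e, f, g] = ![-a + b, -a + b - d + e + g, b - d + e + g, c - d + e + g, c - d + e - f + g, e - f, g] := by
  simp only [w2, LinearEquiv.mul_apply, refl_vec0, refl_vec1, refl_vec2, refl_vec3, refl_vec4,
    refl_vec5]
  ext i
  fin_cases i <;> simp <;> ring

theorem w1_sq : w1 ^ 2 = 1 := by
  apply ext_vec7
  intros
  simp only [pow_succ, pow_zero, one_mul, LinearEquiv.mul_apply, w1_vec, LinearEquiv.coe_one, id]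
  ext i
  fin_cases i <;> simp <;> ring

theorem w2_pow : w2 ^ 7 = 1 := by
  apply ext_vec7
  intros
  simp only [pow_succ, pow_zero, one_mul, LinearEquiv.mul_apply, w2_vec, LinearEquiv.coe_one, id]
  ext i
  fin_cases i <;> simp <;> ring

theorem w1_w2 : w1 * w2 * w1 = w2⁻¹ := by
  rw [eq_inv_iff_mul_eq_one]
  apply ext_vec7
  intros
  simp only [LinearEquiv.mul_apply, w1_vec, w2_vec, LinearEquiv.coe_one, id]
  ext i
  fin_cases i <;> simp <;> ring

theorem w1_ne : w1 ≠ 1 := by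
  intro h
  have h1 := w1_vec 0 0 0 0 1 0 0
  rw [h] at h1
  have h2 := congrFun h1 4
  simp at h2

theorem w2_ne : w2 ≠ 1 := by
  intro h
  have h1 := w2_vec 0 0 0 0 0 1 0
  rw [h] at h1
  have h2 := congrFun h1 5
  simp at h2

theorem closure_dihedral {G : Type*} [Group G] (x y : G) (hx : x ^ 2 = 1) (hy : y ^ 7 = 1)
    (hxy : x * y * x = y⁻¹) (hx1 : x ≠ 1) (hy1 : y ≠ 1) :
    Nonempty ((Subgroup.closure {x, y} : Subgroup G) ≃* DihedralGroup 7) := by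
  have hxx : x * x = 1 := by rw [← sq, hx]
  have hxi : x⁻¹ = x := inv_eq_of_mul_eq_one_left hxx
  have hadd : ∀ i j : ZMod 7, y ^ (i + j).val = y ^ i.val * y ^ j.val := by
    intro i j
    rw [ZMod.val_add, ← pow_add, ← pow_eq_pow_mod _ hy]
  have hsub : ∀ i j : ZMod 7, y ^ (j - i).val = (y ^ i.val)⁻¹ * y ^ j.val := by
    intro i j
    rw [eq_inv_mul_iff_mul_eq, ← hadd, add_sub_cancel]
  have hconj : ∀ k : ℕ, x * y ^ k * x = (y ^ k)⁻¹ := by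
    intro k
    have h := conj_pow (i := k) (a := x) (b := y)
    rw [hxi, hxy] at h
    rw [← h, inv_pow]
  have hcomm : ∀ k : ℕ, y ^ k * x = x * (y ^ k)⁻¹ := by
    intro k
    rw [← hconj k, ← mul_assoc, ← mul_assoc, hxx, one_mul]
  have hoy : orderOf y = 7 := by
    haveI : Fact (Nat.Prime 7) := ⟨by norm_num⟩
    exact orderOf_eq_prime hy hy1
  let F : DihedralGroup 7 → G := fun d => match d with
    | .r i => y ^ i.val
    | .sr i => x * y ^ i.val
  let f : DihedralGroup 7 →* G := MonoidHom.mk' F (by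
    rintro (i | i) (j | j)
    · exact hadd i j
    · change x * y ^ (j - i).val = y ^ i.val * (x * y ^ j.val)
      rw [hsub, ← mul_assoc, ← mul_assoc, hcomm]
    · change x * y ^ (i + j).val = x * y ^ i.val * y ^ j.val
      rw [hadd, mul_assoc]
    · change y ^ (j - i).val = x * y ^ i.val * (x * y ^ j.val)
      rw [hsub, ← mul_assoc, hconj])
  have hr : ∀ i, f (.r i) = y ^ i.val := fun _ => rfl
  have hsr : ∀ i, f (.sr i) = x * y ^ i.val := fun _ => rfl
  have hinj : Function.Injective f := by
    rw [injective_iff_map_eq_one]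
    rintro (i | i) h
    · rw [hr] at h
      have h7 := orderOf_dvd_of_pow_eq_one h
      rw [hoy] at h7
      have h0 : i.val = 0 := Nat.eq_zero_of_dvd_of_lt h7 (ZMod.val_lt i)
      rw [(ZMod.val_eq_zero i).1 h0]
      rfl
    · exfalso
      rw [hsr] at h
      apply hx1
      have h1 : x = (y ^ i.val)⁻¹ := eq_inv_of_mul_eq_one_left h
      have h2 : x ^ 7 = 1 := by
        rw [h1, inv_pow, ← pow_mul, mul_comm, pow_mul, hy, one_pow, inv_one]
      calc x = x ^ 7 := by rw [show 7 = 2 * 3 + 1 from rfl, pow_add, pow_mul, hx]; simp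
        _ = 1 := h2
  have hrange : f.range = Subgroup.closure {x, y} := by
    have hxm : x ∈ Subgroup.closure {x, y} := Subgroup.subset_closure (by simp)
    have hym : y ∈ Subgroup.closure {x, y} := Subgroup.subset_closure (by simp)
    apply le_antisymm
    · rintro _ ⟨i | i, rfl⟩
      · exact Subgroup.pow_mem _ hym _
      · exact Subgroup.mul_mem _ hxm (Subgroup.pow_mem _ hym _)
    · rw [Subgroup.closure_le]
      rintro z (rfl | rfl)
      · exact ⟨.sr 0, by rw [hsr]; simp⟩
      · exact ⟨.r 1, by rw [hr, show (1 : ZMod 7).val = 1 from rfl, pow_one]⟩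
  rw [← hrange]
  exact ⟨(MonoidHom.ofInjective hinj).symm⟩

/-- w₁² = id, w₂⁷ = id, w₁w₂w₁ = w₂⁻¹, w₁ ≠ id, w₂ ≠ id, and ⟨w₁, w₂⟩ (a subgroup of the
group of linear automorphisms of ℤ⁷) is isomorphic to the dihedral group of order 14. -/
theorem stmt5 :
    w1 ^ 2 = 1 ∧ w2 ^ 7 = 1 ∧ w1 * w2 * w1 = w2⁻¹ ∧ w1 ≠ 1 ∧ w2 ≠ 1 ∧
    Nonempty ((Subgroup.closure {w1, w2} :
      Subgroup ((Fin 7 → ℤ) ≃ₗ[ℤ] (Fin 7 → ℤ))) ≃* DihedralGroup 7) := by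
  exact ⟨w1_sq, w2_pow, w1_w2, w1_ne, w2_ne,
    closure_dihedral w1 w2 w1_sq w2_pow w1_w2 w1_ne w2_ne⟩
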